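/- For every ε ∈ (0,1) there exists a constant A = A(ε) such that the following holds. Let w be a weight on [0,1) with dyadic A₂ characteristic [w]_{A₂} < ∞, let 𝒮 ⊆ 𝒟 be an ε-sparse family, and let φ be a measurable function with 0 ≤ φ(x) ≤ w^{-1}(x) for almost every x ∈ [0,1). Then w({x ∈ [0,1) : (S^sp_𝒮 φ(x))² > 3}) ≤ A [w]_{A₂} ∫_0^1 φ dx. -/

import Mathlib

open MeasureTheory

noncomputable section

/-- The dyadic interval `[k/2^n, (k+1)/2^n)`. -/
def dyadicI (n k : ℕ) : Set ℝ := Set.Ico ((k : ℝ) / 2 ^ n) (((k : ℝ) + 1) / 2 ^ n)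

/-- The length of a dyadic interval of generation `n`. -/
def dyadicLen (n : ℕ) : ℝ := 1 / 2 ^ n

/-- The average `⟨f⟩_I` of `f` over the dyadic interval `I = (n,k)`. -/
def avg (f : ℝ → ℝ) (n k : ℕ) : ℝ := (2 : ℝ) ^ n * ∫ x in dyadicI n k, f x

/-- A family `𝒮` of dyadic intervals of `[0,1)` (encoded by pairs `(n,k)`, `k < 2^n`) is
`ε`-sparse: for every `J ∈ 𝒮`, `Σ_{I ∈ 𝒮, I ⊊ J} |I| ≤ ε |J|` (expressed through all finite
subfamilies). -/
def IsSparse (ε : ℝ) (𝒮 : Set (ℕ × ℕ)) : Prop :=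
  (∀ p ∈ 𝒮, p.2 < 2 ^ p.1) ∧
  ∀ p ∈ 𝒮, ∀ F : Finset (ℕ × ℕ),
    (∀ q ∈ F, q ∈ 𝒮 ∧ dyadicI q.1 q.2 ⊂ dyadicI p.1 p.2) →
    ∑ q ∈ F, dyadicLen q.1 ≤ ε * dyadicLen p.1

/-- The square of the sparse square function, `(S^sp_𝒮 φ(x))² = Σ_{I∈𝒮} ⟨|φ|⟩_I² 1_I(x)`,
valued in `ℝ≥0∞`. -/
def sparseSqSq (𝒮 : Set (ℕ × ℕ)) (φ : ℝ → ℝ) (x : ℝ) : ENNReal :=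
  ∑' p : 𝒮, Set.indicator (dyadicI p.1.1 p.1.2)
    (fun _ => ENNReal.ofReal ((avg (fun y => |φ y|) p.1.1 p.1.2) ^ 2)) x

theorem Nat.exists_count_eq_of_lt_count (P : ℕ → Prop) [DecidablePred P] {m n : ℕ}
    (h : m < Nat.count P n) : ∃ j < n, P j ∧ Nat.count P j = m := by
  induction n with
  | zero => simp at h
  | succ n ih =>
    rw [Nat.count_succ] at h
    by_cases hm : m < Nat.count P n
    · obtain ⟨j, hj, hP⟩ := ih hm
      exact ⟨j, by omega, hP⟩
    · by_cases hP : P n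
      · simp only [hP, if_true] at h
        exact ⟨n, by omega, hP, by omega⟩
      · simp only [hP, if_false] at h
        omega

theorem ENNReal.tsum_ite_le_of_count_le (P : ℕ → Prop) [DecidablePred P] {m : ℕ}
    (h : ∀ n, Nat.count P n ≤ m) (c : ENNReal) :
    ∑' n, (if P n then c else 0) ≤ m * c := by
  rw [ENNReal.tsum_eq_iSup_nat]
  refine iSup_le fun n => ?_
  rw [← Finset.sum_filter, Finset.sum_const, nsmul_eq_mul, ← Nat.count_eq_card_filter_range]
  gcongr
  exact_mod_cast h n

theorem mem_dyadicI_iff {x : ℝ} {n k : ℕ} :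
    x ∈ dyadicI n k ↔ 0 ≤ x ∧ ⌊x * 2 ^ n⌋₊ = k := by
  have h2 : (0 : ℝ) < 2 ^ n := by positivity
  simp only [dyadicI, Set.mem_Ico, div_le_iff₀ h2, lt_div_iff₀ h2]
  constructor
  · rintro ⟨h, h'⟩
    have hx : 0 ≤ x * 2 ^ n := (Nat.cast_nonneg k).trans h
    exact ⟨nonneg_of_mul_nonneg_left hx h2, (Nat.floor_eq_iff hx).2 ⟨h, h'⟩⟩
  · rintro ⟨h, h'⟩
    exact (Nat.floor_eq_iff (by positivity)).1 h'

theorem floor_of_mem_dyadicI {x : ℝ} {n k j : ℕ} (hx : x ∈ dyadicI n k) (hj : j ≤ n) :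
    ⌊x * 2 ^ j⌋₊ = k / 2 ^ (n - j) := by
  obtain ⟨-, rfl⟩ := mem_dyadicI_iff.1 hx
  have : x * 2 ^ j = x * 2 ^ n / ((2 ^ (n - j) : ℕ) : ℝ) := by
    rw [eq_div_iff (by positivity)]
    push_cast
    rw [mul_assoc, ← pow_add, Nat.add_sub_cancel' hj]
  rw [this, Nat.floor_div_natCast]

theorem measurableSet_dyadicI (n k : ℕ) : MeasurableSet (dyadicI n k) := measurableSet_Ico

theorem volume_dyadicI (n k : ℕ) : volume (dyadicI n k) = ENNReal.ofReal (dyadicLen n) := by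
  rw [dyadicI, Real.volume_Ico, dyadicLen]
  congr 1
  ring

theorem dyadicLen_pos (n : ℕ) : 0 < dyadicLen n := by
  unfold dyadicLen
  positivity

theorem dyadicI_subset_Ico {n k : ℕ} (hk : k < 2 ^ n) : dyadicI n k ⊆ Set.Ico 0 1 := by
  intro x hx
  refine ⟨(mem_dyadicI_iff.1 hx).1, hx.2.trans_le ?_⟩
  rw [div_le_one (by positivity)]
  exact_mod_cast hk

theorem integral_dyadicI_eq (f : ℝ → ℝ) (n k : ℕ) :
    ∫ x in dyadicI n k, f x = avg f n k * dyadicLen n := by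
  rw [avg, dyadicLen]
  field_simp

/-- Among dyadic intervals with a common point, the one of larger generation is strictly
smaller. -/
theorem dyadicI_ssubset_of_mem {x : ℝ} {n k j l : ℕ} (hx : x ∈ dyadicI n k)
    (hx' : x ∈ dyadicI j l) (hj : j < n) : dyadicI n k ⊂ dyadicI j l := by
  refine ⟨fun y hy => mem_dyadicI_iff.2 ⟨(mem_dyadicI_iff.1 hy).1, ?_⟩, fun h => ?_⟩
  · rw [floor_of_mem_dyadicI hy hj.le, ← floor_of_mem_dyadicI hx hj.le, (mem_dyadicI_iff.1 hx').2]
  · have := measure_mono (μ := volume) h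
    rw [volume_dyadicI, volume_dyadicI, ENNReal.ofReal_le_ofReal_iff (dyadicLen_pos n).le] at this
    exact absurd this (not_le.2 (one_div_lt_one_div_of_lt (by positivity)
      (pow_lt_pow_right₀ one_lt_two hj)))

/-- For `x ≥ 0`: the dyadic interval of generation `n` containing `x` belongs to `𝒯`. -/
def containsAt (𝒯 : Set (ℕ × ℕ)) (x : ℝ) (n : ℕ) : Prop := (n, ⌊x * 2 ^ n⌋₊) ∈ 𝒯

open Classical in
/-- The members of `𝒯` having exactly `m` proper ancestors in `𝒯`. -/
def layer (𝒯 : Set (ℕ × ℕ)) (m : ℕ) : Set (ℕ × ℕ) :=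
  {p ∈ 𝒯 | Nat.count (fun j => (j, p.2 / 2 ^ (p.1 - j)) ∈ 𝒯) p.1 = m}

/-- The points lying in at least `m + 1` members of `𝒯`. -/
def layerSet (𝒯 : Set (ℕ × ℕ)) (m : ℕ) : Set ℝ := ⋃ p ∈ layer 𝒯 m, dyadicI p.1 p.2

open Classical in
theorem mem_layer_iff_of_mem {𝒯 : Set (ℕ × ℕ)} {m : ℕ} {x : ℝ} {p : ℕ × ℕ}
    (hx : x ∈ dyadicI p.1 p.2) :
    p ∈ layer 𝒯 m ↔ containsAt 𝒯 x p.1 ∧ Nat.count (containsAt 𝒯 x) p.1 = m := by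
  have h1 : containsAt 𝒯 x p.1 ↔ p ∈ 𝒯 := by rw [containsAt, (mem_dyadicI_iff.1 hx).2]
  have h2 : Nat.count (containsAt 𝒯 x) p.1
      = Nat.count (fun j => (j, p.2 / 2 ^ (p.1 - j)) ∈ 𝒯) p.1 := by
    simp only [Nat.count_eq_card_filter_range]
    congr 1
    refine Finset.filter_congr fun j hj => ?_
    rw [containsAt, floor_of_mem_dyadicI hx (Finset.mem_range.1 hj).le]
  rw [h1, h2]
  rfl

open Classical in
theorem mem_layerSet_iff {𝒯 : Set (ℕ × ℕ)} {m : ℕ} {x : ℝ} :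
    x ∈ layerSet 𝒯 m ↔
      0 ≤ x ∧ ∃ n, containsAt 𝒯 x n ∧ Nat.count (containsAt 𝒯 x) n = m := by
  simp only [layerSet, Set.mem_iUnion, exists_prop]
  constructor
  · rintro ⟨p, hp, hx⟩
    exact ⟨(mem_dyadicI_iff.1 hx).1, p.1, (mem_layer_iff_of_mem hx).1 hp⟩
  · rintro ⟨h0, n, hn⟩
    have hx : x ∈ dyadicI n ⌊x * 2 ^ n⌋₊ := mem_dyadicI_iff.2 ⟨h0, rfl⟩
    exact ⟨(n, ⌊x * 2 ^ n⌋₊), (mem_layer_iff_of_mem (p := (n, _)) hx).2 hn, hx⟩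

open Classical in
theorem count_containsAt_le {𝒯 : Set (ℕ × ℕ)} {m : ℕ} {x : ℝ} (h0 : 0 ≤ x)
    (hx : x ∉ layerSet 𝒯 m) (n : ℕ) : Nat.count (containsAt 𝒯 x) n ≤ m := by
  by_contra! h
  obtain ⟨j, -, hj⟩ := Nat.exists_count_eq_of_lt_count _ h
  exact hx (mem_layerSet_iff.2 ⟨h0, j, hj⟩)

theorem pairwiseDisjoint_layer (𝒯 : Set (ℕ × ℕ)) (m : ℕ) :
    (layer 𝒯 m).PairwiseDisjoint (fun p => dyadicI p.1 p.2) := by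
  classical
  intro p hp q hq hpq
  refine Set.disjoint_left.2 fun x hxp hxq => hpq ?_
  obtain ⟨hp1, hp2⟩ := (mem_layer_iff_of_mem hxp).1 hp
  obtain ⟨hq1, hq2⟩ := (mem_layer_iff_of_mem hxq).1 hq
  have h1 : p.1 = q.1 := Nat.count_injective hp1 hq1 (hp2.trans hq2.symm)
  refine Prod.ext h1 ?_
  rw [← (mem_dyadicI_iff.1 hxp).2, ← (mem_dyadicI_iff.1 hxq).2, h1]

theorem measure_layerSet (μ : Measure ℝ) (𝒯 : Set (ℕ × ℕ)) (m : ℕ) :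
    μ (layerSet 𝒯 m) = ∑' p : layer 𝒯 m, μ (dyadicI p.1.1 p.1.2) :=
  measure_biUnion (Set.to_countable _) (pairwiseDisjoint_layer 𝒯 m)
    fun p _ => measurableSet_dyadicI p.1 p.2

theorem measure_layerSet_le {μ ν : Measure ℝ} {𝒯 : Set (ℕ × ℕ)} {c : ENNReal}
    (h : ∀ p ∈ 𝒯, μ (dyadicI p.1 p.2) ≤ c * ν (dyadicI p.1 p.2)) (m : ℕ) :
    μ (layerSet 𝒯 m) ≤ c * ν (layerSet 𝒯 m) := by
  rw [measure_layerSet, measure_layerSet, ← ENNReal.tsum_mul_left]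
  exact ENNReal.tsum_le_tsum fun p => h p.1 p.2.1

theorem layerSet_subset_Ico {𝒯 : Set (ℕ × ℕ)} (h : ∀ p ∈ 𝒯, p.2 < 2 ^ p.1) (m : ℕ) :
    layerSet 𝒯 m ⊆ Set.Ico 0 1 :=
  Set.iUnion₂_subset fun p hp => dyadicI_subset_Ico (h p hp.1)

theorem IsSparse.mono {ε : ℝ} {𝒮 𝒯 : Set (ℕ × ℕ)} (h : IsSparse ε 𝒮) (hT : 𝒯 ⊆ 𝒮) :
    IsSparse ε 𝒯 :=
  ⟨fun p hp => h.1 p (hT hp), fun p hp F hF =>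
    h.2 p (hT hp) F fun q hq => ⟨hT (hF q hq).1, (hF q hq).2⟩⟩

theorem IsSparse.tsum_volume_le {ε : ℝ} {𝒯 : Set (ℕ × ℕ)} (h : IsSparse ε 𝒯) (hε : 0 ≤ ε)
    {p : ℕ × ℕ} (hp : p ∈ 𝒯) :
    ∑' q : {q ∈ 𝒯 | dyadicI q.1 q.2 ⊂ dyadicI p.1 p.2}, volume (dyadicI q.1.1 q.1.2)
      ≤ ENNReal.ofReal ε * volume (dyadicI p.1 p.2) := by
  rw [ENNReal.tsum_eq_iSup_sum]
  refine iSup_le fun F => ?_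
  simp only [volume_dyadicI]
  rw [← ENNReal.ofReal_mul hε, ← ENNReal.ofReal_sum_of_nonneg fun q _ => (dyadicLen_pos _).le]
  refine ENNReal.ofReal_le_ofReal ?_
  have := h.2 p hp (F.map (Function.Embedding.subtype _)) (by
    intro q hq
    obtain ⟨r, -, rfl⟩ := Finset.mem_map.1 hq
    exact r.2)
  rwa [Finset.sum_map] at this

theorem IsSparse.volume_layerSet_succ_le {ε : ℝ} {𝒯 : Set (ℕ × ℕ)} (h : IsSparse ε 𝒯)
    (hε : 0 ≤ ε) (m : ℕ) :
    volume (layerSet 𝒯 (m + 1)) ≤ ENNReal.ofReal ε * volume (layerSet 𝒯 m) := by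
  classical
  have hsub : layerSet 𝒯 (m + 1) ⊆ ⋃ p : layer 𝒯 m,
      ⋃ q : {q ∈ 𝒯 | dyadicI q.1 q.2 ⊂ dyadicI p.1.1 p.1.2}, dyadicI q.1.1 q.1.2 := by
    intro x hx
    obtain ⟨h0, n, hn, hc⟩ := mem_layerSet_iff.1 hx
    obtain ⟨j, hj, hj'⟩ :=
      Nat.exists_count_eq_of_lt_count (containsAt 𝒯 x) (m := m) (n := n) (by omega)
    have hxn : x ∈ dyadicI n ⌊x * 2 ^ n⌋₊ := mem_dyadicI_iff.2 ⟨h0, rfl⟩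
    have hxj : x ∈ dyadicI j ⌊x * 2 ^ j⌋₊ := mem_dyadicI_iff.2 ⟨h0, rfl⟩
    simp only [Set.mem_iUnion]
    exact ⟨⟨(j, ⌊x * 2 ^ j⌋₊), (mem_layer_iff_of_mem (p := (j, _)) hxj).2 hj'⟩,
      ⟨(n, ⌊x * 2 ^ n⌋₊), hn, dyadicI_ssubset_of_mem hxn hxj hj⟩, hxn⟩
  rw [measure_layerSet volume 𝒯 m, ← ENNReal.tsum_mul_left]
  refine (measure_mono hsub).trans ((measure_iUnion_le _).trans ?_)
  exact ENNReal.tsum_le_tsum fun p => (measure_iUnion_le _).trans (h.tsum_volume_le hε p.2.1)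

theorem IsSparse.volume_layerSet_le {ε : ℝ} {𝒯 : Set (ℕ × ℕ)} (h : IsSparse ε 𝒯)
    (hε : 0 ≤ ε) (m : ℕ) :
    volume (layerSet 𝒯 m) ≤ ENNReal.ofReal (ε ^ m) * volume (layerSet 𝒯 0) := by
  induction m with
  | zero => simp
  | succ m ih =>
    refine (h.volume_layerSet_succ_le hε m).trans ?_
    rw [pow_succ', ENNReal.ofReal_mul hε, mul_assoc]
    gcongr

/-- The family of intervals of `𝒯` on which the average of `g` is comparable to `2 ^ (-k)`. -/
def avgLevel (𝒯 : Set (ℕ × ℕ)) (g : ℝ → ℝ) (k : ℕ) : Set (ℕ × ℕ) :=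
  {p ∈ 𝒯 | (1 / 2 : ℝ) ^ (k + 1) < avg g p.1 p.2 ∧ avg g p.1 p.2 ≤ (1 / 2) ^ k}

/-- The dyadic intervals of `[0,1)` on which the average of `g` exceeds `1`. -/
def largeAvg (g : ℝ → ℝ) : Set (ℕ × ℕ) :=
  {p | p.2 < 2 ^ p.1 ∧ 1 < avg g p.1 p.2}

theorem volume_dyadicI_le_of_lt_avg {g : ℝ → ℝ} (hg : ∀ x, 0 ≤ g x) {n k : ℕ}
    (hgi : IntegrableOn g (dyadicI n k)) {t : ℝ} (ht : 0 < t) (h : t ≤ avg g n k) :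
    volume (dyadicI n k)
      ≤ ENNReal.ofReal t⁻¹ * volume.withDensity (fun x => ENNReal.ofReal (g x)) (dyadicI n k) := by
  rw [withDensity_apply _ (measurableSet_dyadicI n k),
    ← ofReal_integral_eq_lintegral_ofReal hgi (ae_of_all _ hg), volume_dyadicI,
    ← ENNReal.ofReal_mul (by positivity), integral_dyadicI_eq]
  refine ENNReal.ofReal_le_ofReal ?_
  rw [le_inv_mul_iff₀ ht]
  exact mul_le_mul_of_nonneg_right h (dyadicLen_pos n).le

theorem withDensity_dyadicI_le_of_avg_mul_le {w : ℝ → ℝ} {n k : ℕ}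
    (hw : ∀ x ∈ dyadicI n k, 0 ≤ w x) (hwi : IntegrableOn w (dyadicI n k))
    {t Q : ℝ} (ht : 0 < t) (h : avg w n k * t ≤ Q) :
    volume.withDensity (fun x => ENNReal.ofReal (w x)) (dyadicI n k)
      ≤ ENNReal.ofReal (Q * t⁻¹) * volume (dyadicI n k) := by
  rw [withDensity_apply _ (measurableSet_dyadicI n k),
    ← ofReal_integral_eq_lintegral_ofReal hwi
      (ae_restrict_of_forall_mem (measurableSet_dyadicI n k) hw), volume_dyadicI,
    ← ENNReal.ofReal_mul' (dyadicLen_pos n).le, integral_dyadicI_eq]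
  refine ENNReal.ofReal_le_ofReal (mul_le_mul_of_nonneg_right ?_ (dyadicLen_pos n).le)
  rwa [← div_eq_mul_inv, le_div_iff₀ ht]

theorem sparseSqSq_eq_tsum {𝒮 : Set (ℕ × ℕ)} {φ : ℝ → ℝ} {x : ℝ} (hx : 0 ≤ x)
    [DecidablePred (containsAt 𝒮 x)] :
    sparseSqSq 𝒮 φ x = ∑' n, if containsAt 𝒮 x n then
      ENNReal.ofReal (avg (fun y => |φ y|) n ⌊x * 2 ^ n⌋₊ ^ 2) else 0 := by
  classical
  rw [sparseSqSq, tsum_subtype 𝒮 (fun p => Set.indicator (dyadicI p.1 p.2)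
    (fun _ => ENNReal.ofReal ((avg (fun y => |φ y|) p.1 p.2) ^ 2)) x), ENNReal.tsum_prod']
  refine tsum_congr fun n => ?_
  rw [tsum_eq_single ⌊x * 2 ^ n⌋₊]
  · simp only [Set.indicator, mem_dyadicI_iff, hx, containsAt, true_and]
    split_ifs <;> simp_all
  · intro k hk
    simp [Set.indicator, mem_dyadicI_iff, hx, hk.symm]

/-- If `x` lies in no interval of large average and in at most `2 ^ k` intervals of `𝒮` of average
comparable to `2 ^ (-k)`, then the sparse square function at `x` is controlled. -/
theorem sparseSqSq_le_two {𝒮 : Set (ℕ × ℕ)} (h𝒮 : ∀ p ∈ 𝒮, p.2 < 2 ^ p.1) {φ : ℝ → ℝ} {x : ℝ}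
    (hx : 0 ≤ x) (hlarge : x ∉ layerSet (largeAvg fun y => |φ y|) 0)
    (hlevel : ∀ k, x ∉ layerSet (avgLevel 𝒮 (fun y => |φ y|) k) (2 ^ k)) :
    sparseSqSq 𝒮 φ x ≤ 2 := by
  classical
  set g : ℝ → ℝ := fun y => |φ y| with hg
  have hgn : ∀ n k, 0 ≤ avg g n k := fun n k => by
    unfold avg
    have : 0 ≤ ∫ x in dyadicI n k, g x := integral_nonneg fun y => abs_nonneg _
    positivity
  have hle1 : ∀ n, containsAt 𝒮 x n → avg g n ⌊x * 2 ^ n⌋₊ ≤ 1 := by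
    intro n hn
    by_contra! h
    have hmem : containsAt (largeAvg g) x n := ⟨h𝒮 _ hn, h⟩
    have := count_containsAt_le hx hlarge (n + 1)
    rw [Nat.count_succ, if_pos hmem] at this
    omega
  calc sparseSqSq 𝒮 φ x
      = ∑' n, if containsAt 𝒮 x n then ENNReal.ofReal (avg g n ⌊x * 2 ^ n⌋₊ ^ 2) else 0 :=
        sparseSqSq_eq_tsum hx
    _ ≤ ∑' n, ∑' k, if containsAt (avgLevel 𝒮 g k) x n then
          ENNReal.ofReal ((1 / 4 : ℝ) ^ k) else 0 := by
        refine ENNReal.tsum_le_tsum fun n => ?_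
        split_ifs with hn
        swap
        · exact zero_le
        rcases (hgn n ⌊x * 2 ^ n⌋₊).eq_or_lt with h0 | h0
        · simp [← h0]
        obtain ⟨k, hk1, hk2⟩ := exists_nat_pow_near_of_lt_one h0 (hle1 n hn)
          (by norm_num : (0 : ℝ) < 1 / 2) (by norm_num)
        refine le_trans ?_ (ENNReal.le_tsum k)
        rw [if_pos (show containsAt (avgLevel 𝒮 g k) x n from ⟨hn, hk1, hk2⟩)]
        refine ENNReal.ofReal_le_ofReal ?_
        calc avg g n ⌊x * 2 ^ n⌋₊ ^ 2 ≤ ((1 / 2 : ℝ) ^ k) ^ 2 := by gcongr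
          _ = (1 / 4) ^ k := by rw [← pow_mul, mul_comm, pow_mul]; norm_num
    _ = ∑' k, ∑' n, if containsAt (avgLevel 𝒮 g k) x n then
          ENNReal.ofReal ((1 / 4 : ℝ) ^ k) else 0 := ENNReal.tsum_comm
    _ ≤ ∑' k : ℕ, ENNReal.ofReal ((1 / 2 : ℝ) ^ k) := by
        refine ENNReal.tsum_le_tsum fun k => ?_
        refine (ENNReal.tsum_ite_le_of_count_le _
          (count_containsAt_le hx (hlevel k)) _).trans_eq ?_
        rw [← ENNReal.ofReal_natCast, ← ENNReal.ofReal_mul (by positivity)]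
        push_cast
        rw [← mul_pow]
        norm_num
    _ = 2 := by
        rw [← ENNReal.ofReal_tsum_of_nonneg (fun k => by positivity) summable_geometric_two,
          tsum_geometric_two]
        norm_num

/-- for every `ε ∈ (0,1)` there is `A = A(ε) > 0` such that for every weight
`w` on `[0,1)` with `[w]_{A₂} ≤ Q`, every `ε`-sparse family `𝒮`, and every measurable `φ`
with `0 ≤ φ ≤ w⁻¹` a.e. on `[0,1)`,
`w({x ∈ [0,1) : (S^sp_𝒮 φ(x))² > 3}) ≤ A [w]_{A₂} ∫_0^1 φ`. -/
theorem sparse_test_function_estimate :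
    ∀ ε : ℝ, 0 < ε → ε < 1 →
      ∃ A : ℝ, 0 < A ∧
        ∀ w : ℝ → ℝ, Measurable w →
          (∀ x ∈ Set.Ico (0 : ℝ) 1, 0 < w x) →
          IntegrableOn w (Set.Ico (0 : ℝ) 1) →
          IntegrableOn (fun x => (w x)⁻¹) (Set.Ico (0 : ℝ) 1) →
        ∀ Q : ℝ,
          (∀ n k : ℕ, k < 2 ^ n →
            avg w n k * avg (fun x => (w x)⁻¹) n k ≤ Q) →
        ∀ 𝒮 : Set (ℕ × ℕ), IsSparse ε 𝒮 →
        ∀ φ : ℝ → ℝ, Measurable φ →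
          (∀ᵐ x ∂(volume.restrict (Set.Ico (0 : ℝ) 1)), 0 ≤ φ x ∧ φ x ≤ (w x)⁻¹) →
          (∫ x in {x : ℝ | x ∈ Set.Ico (0 : ℝ) 1 ∧ (3 : ENNReal) < sparseSqSq 𝒮 φ x}, w x)
            ≤ A * Q * ∫ x in Set.Ico (0 : ℝ) 1, φ x := by
  intro ε hε0 hε1
  set a : ℕ → ℝ := fun k => (2 ^ (k + 1)) ^ 2 * ε ^ (2 ^ k) with ha
  have ha0 : ∀ k, 0 ≤ a k := fun k => by positivity
  have hsum : Summable a := by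
    have h := (summable_pow_mul_geometric_of_norm_lt_one 2
      (show ‖ε‖ < 1 by rwa [Real.norm_of_nonneg hε0.le])).comp_injective
      (Nat.pow_right_injective le_rfl)
    refine (h.mul_left 4).congr fun k => ?_
    simp only [ha, Function.comp_apply]
    push_cast
    ring
  have hsum0 : 0 ≤ ∑' k, a k := tsum_nonneg ha0
  refine ⟨1 + ∑' k, a k, by positivity, ?_⟩
  intro w hwm hwpos hwi hwinv Q hQ 𝒮 h𝒮 φ hφm hφ
  set g : ℝ → ℝ := fun y => |φ y| with hg
  have hgi : IntegrableOn g (Set.Ico 0 1) := by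
    refine Integrable.mono' hwinv hφm.abs.aestronglyMeasurable ?_
    filter_upwards [hφ] with x hx
    rw [hg, Real.norm_eq_abs, abs_abs, abs_of_nonneg hx.1]
    exact hx.2
  have hφg : ∫ x in Set.Ico (0 : ℝ) 1, φ x = ∫ x in Set.Ico (0 : ℝ) 1, g x := by
    refine integral_congr_ae ?_
    filter_upwards [hφ] with x hx
    exact (abs_of_nonneg hx.1).symm
  have hwn : ∀ n k, k < 2 ^ n → 0 ≤ avg w n k := fun n k hk => by
    have := setIntegral_nonneg (μ := volume) (measurableSet_dyadicI n k)
      fun x hx => (hwpos x (dyadicI_subset_Ico hk hx)).le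
    unfold avg
    positivity
  have hgw : ∀ n k, k < 2 ^ n → avg g n k ≤ avg (fun x => (w x)⁻¹) n k := fun n k hk => by
    have hs := dyadicI_subset_Ico hk
    unfold avg
    refine mul_le_mul_of_nonneg_left ?_ (by positivity)
    refine integral_mono_ae (hgi.mono_set hs) (hwinv.mono_set hs) ?_
    filter_upwards [ae_restrict_of_ae_restrict_of_subset hs hφ] with x hx
    exact (abs_of_nonneg hx.1).trans_le hx.2
  have hQ0 : 0 ≤ Q := by
    refine le_trans (mul_nonneg (hwn 0 0 (by simp)) ?_) (hQ 0 0 (by simp))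
    refine le_trans ?_ (hgw 0 0 (by simp))
    exact mul_nonneg (by positivity) (integral_nonneg fun y => abs_nonneg _)
  set ν := volume.withDensity (fun x => ENNReal.ofReal (w x)) with hν
  set η := volume.withDensity (fun x => ENNReal.ofReal (g x)) with hη
  have hηval : η (Set.Ico 0 1) = ENNReal.ofReal (∫ x in Set.Ico (0 : ℝ) 1, φ x) := by
    rw [hη, withDensity_apply _ measurableSet_Ico, hφg,
      ofReal_integral_eq_lintegral_ofReal hgi (ae_of_all _ fun y => abs_nonneg _)]
  have key : ∀ (𝒯 : Set (ℕ × ℕ)) (t : ℝ) (c : ℝ) (m : ℕ), 0 < t → 0 ≤ c →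
      (∀ p ∈ 𝒯, p.2 < 2 ^ p.1 ∧ t ≤ avg g p.1 p.2) →
      volume (layerSet 𝒯 m) ≤ ENNReal.ofReal c * volume (layerSet 𝒯 0) →
      ν (layerSet 𝒯 m) ≤ ENNReal.ofReal (t⁻¹ ^ 2 * c)
        * ENNReal.ofReal (Q * ∫ x in Set.Ico (0 : ℝ) 1, φ x) := by
    intro 𝒯 t c m ht hc h𝒯 hvol
    have h1 : ν (layerSet 𝒯 m) ≤ ENNReal.ofReal (Q * t⁻¹) * volume (layerSet 𝒯 m) :=
      measure_layerSet_le (fun p hp => by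
        obtain ⟨hk, hpt⟩ := h𝒯 p hp
        have hs := dyadicI_subset_Ico hk
        refine withDensity_dyadicI_le_of_avg_mul_le (fun x hx => (hwpos x (hs hx)).le)
          (hwi.mono_set hs) ht ((mul_le_mul_of_nonneg_left ?_ (hwn _ _ hk)).trans (hQ _ _ hk))
        exact hpt.trans (hgw _ _ hk)) m
    have h2 : volume (layerSet 𝒯 0) ≤ ENNReal.ofReal t⁻¹ * η (layerSet 𝒯 0) :=
      measure_layerSet_le (fun p hp => volume_dyadicI_le_of_lt_avg (fun y => abs_nonneg _)
        (hgi.mono_set (dyadicI_subset_Ico (h𝒯 p hp).1)) ht (h𝒯 p hp).2) 0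
    have h3 : η (layerSet 𝒯 0) ≤ η (Set.Ico 0 1) :=
      measure_mono (layerSet_subset_Ico (fun p hp => (h𝒯 p hp).1) 0)
    calc ν (layerSet 𝒯 m)
        ≤ ENNReal.ofReal (Q * t⁻¹) * (ENNReal.ofReal c * (ENNReal.ofReal t⁻¹
          * ENNReal.ofReal (∫ x in Set.Ico (0 : ℝ) 1, φ x))) := by
          refine h1.trans ?_
          gcongr
          refine hvol.trans ?_
          gcongr
          refine h2.trans ?_
          gcongr
          exact h3.trans_eq hηval
      _ = _ := by
          rw [← ENNReal.ofReal_mul (by positivity), ← ENNReal.ofReal_mul hc,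
            ← ENNReal.ofReal_mul (by positivity), ← ENNReal.ofReal_mul (by positivity)]
          congr 1
          ring
  set E := {x : ℝ | x ∈ Set.Ico (0 : ℝ) 1 ∧ (3 : ENNReal) < sparseSqSq 𝒮 φ x} with hE
  have hEI : E ⊆ Set.Ico 0 1 := fun x hx => hx.1
  have hcover : E ⊆ layerSet (largeAvg g) 0 ∪ ⋃ k, layerSet (avgLevel 𝒮 g k) (2 ^ k) := by
    intro x hx
    by_contra hcon
    simp only [Set.mem_union, Set.mem_iUnion, not_or, not_exists] at hcon
    have := hx.2.trans_le (sparseSqSq_le_two h𝒮.1 hx.1.1 hcon.1 hcon.2)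
    norm_num at this
  have hφ0 : 0 ≤ ∫ x in Set.Ico (0 : ℝ) 1, φ x :=
    hφg ▸ integral_nonneg fun y => abs_nonneg _
  have hνE : ν E ≤ ENNReal.ofReal
      ((1 + ∑' k, a k) * Q * ∫ x in Set.Ico (0 : ℝ) 1, φ x) := by
    calc ν E ≤ ν (layerSet (largeAvg g) 0) + ∑' k, ν (layerSet (avgLevel 𝒮 g k) (2 ^ k)) :=
          (measure_mono hcover).trans ((measure_union_le _ _).trans
            (by gcongr; exact measure_iUnion_le _))
      _ ≤ ENNReal.ofReal 1 * ENNReal.ofReal (Q * ∫ x in Set.Ico (0 : ℝ) 1, φ x)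
          + ∑' k, ENNReal.ofReal (a k)
            * ENNReal.ofReal (Q * ∫ x in Set.Ico (0 : ℝ) 1, φ x) := by
          refine add_le_add ?_ (ENNReal.tsum_le_tsum fun k => ?_)
          · simpa using key (largeAvg g) 1 1 0 one_pos zero_le_one
              (fun p hp => ⟨hp.1, hp.2.le⟩) (by simp)
          · have hsp : IsSparse ε (avgLevel 𝒮 g k) := h𝒮.mono fun p hp => hp.1
            simpa [ha] using key (avgLevel 𝒮 g k) ((1 / 2) ^ (k + 1)) (ε ^ 2 ^ k) (2 ^ k)
              (by positivity) (by positivity) (fun p hp => ⟨hsp.1 p hp, hp.2.1.le⟩)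
              (hsp.volume_layerSet_le hε0.le _)
      _ = _ := by
          rw [ENNReal.tsum_mul_right, ← ENNReal.ofReal_tsum_of_nonneg ha0 hsum, ← add_mul,
            ← ENNReal.ofReal_add zero_le_one hsum0, ← ENNReal.ofReal_mul (by positivity),
            mul_assoc]
  have hwE : 0 ≤ᵐ[volume.restrict E] w :=
    ae_restrict_of_ae_restrict_of_subset hEI
      (ae_restrict_of_forall_mem measurableSet_Ico fun x hx => (hwpos x hx).le)
  have htot : 0 ≤ (1 + ∑' k, a k) * Q * ∫ x in Set.Ico (0 : ℝ) 1, φ x := by positivity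
  rw [← ENNReal.ofReal_le_ofReal_iff htot,
    ofReal_integral_eq_lintegral_ofReal (hwi.mono_set hEI) hwE]
  exact (withDensity_apply_le _ E).trans hνE
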